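/- arXiv:2403.18141 — 2 statements merged into one kernel-verified Lean document; each statement's English description precedes it below -/
import Mathlib

section
/- Let R > 1 and let t, t' be R-summable sequences of complex numbers. Then for every k ∈ ℤ the series Σ_{j≥0} h_{k+j}(t) h_j(−t') converges absolutely and J_k(t,t') = Σ_{j≥0} h_{k+j}(t) h_j(−t'). -/
open scoped BigOperators

noncomputable section

/-- `t : ℕ → ℂ` encodes the sequence `(t_1, t_2, …)` via `t n = t_{n+1}`.
`t` is `R`-summable if `∑_{n ≥ 1} |t_n| R^n < ∞`. -/
def RSummable (R : ℝ) (t : ℕ → ℂ) : Prop :=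
  Summable fun n : ℕ => ‖t n‖ * R ^ (n + 1)

/-- `γ(z,t) = exp (∑_{n ≥ 1} t_n z^n)`. -/
def gammaFn (z : ℂ) (t : ℕ → ℂ) : ℂ :=
  Complex.exp (∑' n : ℕ, t n * z ^ (n + 1))

/-- `J(z;t,t') = exp (∑_{n ≥ 1} (t_n z^n − t'_n z^{-n}))`. -/
def Jfun (z : ℂ) (t t' : ℕ → ℂ) : ℂ :=
  Complex.exp (∑' n : ℕ, (t n * z ^ (n + 1) - t' n * z⁻¹ ^ (n + 1)))

/-- `J_k(t,t')`, the `k`-th Laurent coefficient of `z ↦ J(z;t,t')`: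
`J_k(t,t') = (1/(2π)) ∫ ₀^{2π} J(e^{iθ};t,t') e^{-ikθ} dθ`. -/
def Jcoef (t t' : ℕ → ℂ) (k : ℤ) : ℂ :=
  (2 * Real.pi : ℂ)⁻¹ *
    ∫ θ in (0:ℝ)..(2 * Real.pi),
      Jfun (Complex.exp (θ * Complex.I)) t t' * Complex.exp (-(k : ℂ) * θ * Complex.I)

/-- The half-integer `a + 1/2 ∈ ℤ'` is encoded by the integer `a : ℤ`.
The kernel `K_{t,t',σ}(x,y) = ∑_{k ∈ ℤ'} σ(k) J_{x+k}(t,t') J_{-y-k}(-t,-t')`: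
for `x = a + 1/2`, `y = b + 1/2`, `k = c + 1/2` one has `x + k = a + c + 1` and
`-y - k = -(b + c + 1)`. -/
def Kker (t t' : ℕ → ℂ) (σ : ℤ → ℝ) (a b : ℤ) : ℂ :=
  ∑' c : ℤ, (σ c : ℂ) * Jcoef t t' (a + c + 1) * Jcoef (-t) (-t') (-(b + c + 1))

/-- The indicator `1_{ℤ'_{>0}}` of the positive half-integers: `c + 1/2 > 0 ↔ 0 ≤ c`. -/
def posInd : ℤ → ℝ := fun c => if 0 ≤ c then 1 else 0

/-- `Z_{t,t'} = exp (∑_{n ≥ 1} n t_n t'_n)`. -/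
def Zconst (t t' : ℕ → ℂ) : ℂ :=
  Complex.exp (∑' n : ℕ, (n + 1 : ℂ) * t n * t' n)

/-- The Fredholm series `D_n` of a kernel `K` on `ℓ²(ℤ' ∩ (n,∞))`; the half-integer
`a + 1/2` belongs to `(n,∞)` iff `n ≤ a`. -/
def fredholmSeries (K : ℤ → ℤ → ℂ) (n : ℤ) : ℂ :=
  ∑' m : ℕ, ((-1 : ℂ) ^ m / m.factorial) *
    ∑' x : Fin m → {a : ℤ // n ≤ a},
      Matrix.det (Matrix.of fun i j : Fin m => K (x i) (x j))

/-- Absolute convergence of the Fredholm series of `K` on `ℓ²(ℤ' ∩ (n,∞))`. -/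
def FredholmAbsConv (K : ℤ → ℤ → ℂ) (n : ℤ) : Prop :=
  (∀ m : ℕ, Summable fun x : Fin m → {a : ℤ // n ≤ a} =>
      ‖Matrix.det (Matrix.of fun i j : Fin m => K (x i) (x j))‖) ∧
    Summable fun m : ℕ => (m.factorial : ℝ)⁻¹ *
      ∑' x : Fin m → {a : ℤ // n ≤ a},
        ‖Matrix.det (Matrix.of fun i j : Fin m => K (x i) (x j))‖

/-- `τ_n(t,t';σ) = Z_{t,t'} · D_n(t,t';σ)`. -/
def tauFn (σ : ℤ → ℝ) (t t' : ℕ → ℂ) (n : ℤ) : ℂ :=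
  Zconst t t' * fredholmSeries (Kker t t' σ) n

/-- `{z} = (z, z²/2, z³/3, …)`. -/
def chargeSeq (z : ℂ) : ℕ → ℂ := fun n => z ^ (n + 1) / (n + 1)

/-- `h_k(t)`: the Taylor coefficients of `γ(·,t)`, with `h_k(t) = 0` for `k < 0`. -/
def hcoef (t : ℕ → ℂ) (k : ℤ) : ℂ :=
  if k < 0 then 0 else
    (2 * Real.pi : ℂ)⁻¹ *
      ∫ θ in (0:ℝ)..(2 * Real.pi),
        gammaFn (Complex.exp (θ * Complex.I)) t * Complex.exp (-(k : ℂ) * θ * Complex.I)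

/-- Young diagrams (partitions): `part i` is the `(i+1)`-st part `λ_{i+1}`. -/
structure Partition' where
  part : ℕ → ℕ
  antitone : Antitone part
  ev_zero : ∃ N, ∀ i ≥ N, part i = 0

/-- The number `ℓ(λ)` of nonzero parts. -/
def Partition'.len (lam : Partition') : ℕ := sInf {N | lam.part N = 0}

/-- `s_λ(t) = det (h_{λ_i − i + j}(t))_{i,j = 1}^{ℓ(λ)}` (Jacobi–Trudi). -/
def schurPoly (t : ℕ → ℂ) (lam : Partition') : ℂ :=
  Matrix.det (Matrix.of fun i j : Fin lam.len =>
    hcoef t ((lam.part i : ℤ) + (j : ℤ) - (i : ℤ)))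

/-- `S_0(λ) = {λ_i − i + 1/2 : i ≥ 1} ⊂ ℤ'` in integer coordinates
(`a : ℤ` encodes the half-integer `a + 1/2`). -/
def S0 (lam : Partition') : Set ℤ := {a : ℤ | ∃ i : ℕ, a = (lam.part i : ℤ) - (i + 1)}

/-- The multiplicative functional `∏_{x ∈ S_0(λ)} (1 − σ(x − n))
  = ∏_{i ≥ 1} (1 − σ(λ_i − i + 1/2 − n))`. -/
def multFunc (σ : ℤ → ℝ) (n : ℤ) (lam : Partition') : ℝ :=
  ∏' i : ℕ, (1 - σ ((lam.part i : ℤ) - (i + 1) - n))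

/-- The Taylor expansion of `γ(·,t)`, absolutely convergent on the closed unit disc. -/
theorem exists_hasSum_gammaFn {R : ℝ} (hR : 1 < R) {t : ℕ → ℂ} (ht : RSummable R t) :
    ∃ a : ℕ → ℂ, (Summable fun n => ‖a n‖) ∧
      ∀ z : ℂ, ‖z‖ ≤ 1 → HasSum (fun n => a n * z ^ n) (gammaFn z t) := by
  have hd : DifferentiableOn ℂ (fun z => gammaFn z t) (Metric.ball 0 R) := by
    refine DifferentiableOn.cexp ?_
    refine Complex.differentiableOn_tsum_of_summable_norm ht (fun n => by fun_prop)
      Metric.isOpen_ball fun n z hz => ?_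
    rw [norm_mul, norm_pow]
    have : ‖z‖ ≤ R := by simpa using (mem_ball_zero_iff.1 hz).le
    gcongr
  have key : ∀ z : ℂ, ‖z‖ ≤ 1 → HasSum
      (fun n : ℕ => ((n.factorial : ℂ)⁻¹ * iteratedDeriv n (fun z => gammaFn z t) 0) * z ^ n)
      (gammaFn z t) := by
    intro z hz
    have h := Complex.hasSum_taylorSeries_on_ball (r := R) hd
      (mem_ball_zero_iff.2 (hz.trans_lt hR))
    convert! h using 2 with n
    rw [sub_zero, smul_eq_mul, smul_eq_mul]
    ring
  refine ⟨_, ?_, key⟩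
  simpa using (key 1 (by simp)).summable.norm

/-- Coefficient extraction from an absolutely convergent trigonometric series. -/
theorem hasSum_fourierIntegral {ι : Type*} [Countable ι] {c : ι → ℂ} (m : ι → ℤ)
    (hc : Summable fun i => ‖c i‖) {f : ℝ → ℂ}
    (hf : ∀ θ : ℝ, HasSum (fun i => c i * Complex.exp (θ * Complex.I) ^ m i) (f θ)) (k : ℤ) :
    HasSum (fun i => if m i = k then c i else 0)
      ((2 * Real.pi : ℂ)⁻¹ *
        ∫ θ in (0:ℝ)..(2 * Real.pi), f θ * Complex.exp (-(k : ℂ) * θ * Complex.I)) := by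
  have hnorm (θ : ℝ) (n : ℤ) : ‖Complex.exp (θ * Complex.I) ^ n‖ = 1 := by
    rw [norm_zpow, Complex.norm_exp_ofReal_mul_I, one_zpow]
  have hk (θ : ℝ) : Complex.exp (-(k : ℂ) * θ * Complex.I) =
      Complex.exp (θ * Complex.I) ^ (-k) := by
    rw [← Complex.exp_int_mul]; push_cast; ring_nf
  have hcont (n : ℤ) : Continuous fun θ : ℝ => Complex.exp (θ * Complex.I) ^ n := by
    simp_rw [← Complex.exp_int_mul]; fun_prop
  have hint (n : ℤ) : ∫ θ in (0:ℝ)..(2 * Real.pi), Complex.exp (θ * Complex.I) ^ n =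
      if n = 0 then (2 * Real.pi : ℂ) else 0 := by
    split_ifs with hn
    · simp [hn]
    · have hn' : (n : ℂ) * Complex.I ≠ 0 := by simp [hn]
      have h := integral_exp_mul_complex (a := 0) (b := 2 * Real.pi) hn'
      have h1 : Complex.exp ((n : ℂ) * Complex.I * ((2 * Real.pi : ℝ) : ℂ)) = 1 := by
        rw [Complex.exp_eq_one_iff]
        exact ⟨n, by push_cast; ring⟩
      rw [h1] at h
      simp only [Complex.ofReal_zero, mul_zero, Complex.exp_zero, sub_self, zero_div] at h
      rw [← h]
      simp_rw [← Complex.exp_int_mul, mul_right_comm _ Complex.I, mul_assoc]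
  have hsum := intervalIntegral.hasSum_integral_of_dominated_convergence
    (μ := MeasureTheory.volume) (a := 0) (b := 2 * Real.pi)
    (F := fun i (θ : ℝ) => c i * Complex.exp (θ * Complex.I) ^ (m i - k))
    (f := fun θ => f θ * Complex.exp (-(k : ℂ) * θ * Complex.I))
    (fun i _ => ‖c i‖)
    (fun i => ((hcont _).const_mul _).aestronglyMeasurable)
    (fun i => .of_forall fun θ _ => by rw [norm_mul, hnorm, mul_one])
    (.of_forall fun _ _ => hc)
    intervalIntegrable_const
    (.of_forall fun θ _ => by
      rw [hk]
      simpa only [sub_eq_add_neg, zpow_add₀ (Complex.exp_ne_zero _), mul_assoc]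
        using (hf θ).mul_right (Complex.exp (θ * Complex.I) ^ (-k)))
  have hpi : (2 * Real.pi : ℂ) ≠ 0 := by simp [Real.pi_ne_zero]
  convert! hsum.mul_left (2 * Real.pi : ℂ)⁻¹ using 2 with i
  rw [intervalIntegral.integral_const_mul, hint]
  by_cases h : m i = k
  · rw [if_pos h, if_pos (sub_eq_zero.2 h), mul_comm, mul_inv_cancel_right₀ hpi]
  · rw [if_neg h, if_neg (sub_ne_zero.2 h), mul_zero, mul_zero]

/-- `h_k(t)` is the `k`-th coefficient of any absolutely convergent expansion of `γ(·,t)`. -/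
theorem hasSum_hcoef {t : ℕ → ℂ} {a : ℕ → ℂ} (ha : Summable fun n => ‖a n‖)
    (h : ∀ z : ℂ, ‖z‖ ≤ 1 → HasSum (fun n => a n * z ^ n) (gammaFn z t)) (k : ℤ) :
    HasSum (fun n : ℕ => if (n : ℤ) = k then a n else 0) (hcoef t k) := by
  unfold hcoef
  split_ifs with hk
  · convert hasSum_zero (α := ℂ) (β := ℕ) using 2 with n
    rw [if_neg (by lia)]
  · refine hasSum_fourierIntegral (fun n : ℕ => (n : ℤ)) ha (fun θ => ?_) k
    simpa only [zpow_natCast] using h _ (Complex.norm_exp_ofReal_mul_I θ).le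

theorem hcoef_natCast {t : ℕ → ℂ} {a : ℕ → ℂ} (ha : Summable fun n => ‖a n‖)
    (h : ∀ z : ℂ, ‖z‖ ≤ 1 → HasSum (fun n => a n * z ^ n) (gammaFn z t)) (n : ℕ) :
    hcoef t n = a n := by
  refine (hasSum_hcoef ha h n).unique ?_
  convert! hasSum_ite_eq n (a n) using 2 with m
  simp +contextual [eq_comm]

theorem norm_hcoef_le {t : ℕ → ℂ} {a : ℕ → ℂ} (ha : Summable fun n => ‖a n‖)
    (h : ∀ z : ℂ, ‖z‖ ≤ 1 → HasSum (fun n => a n * z ^ n) (gammaFn z t)) (k : ℤ) :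
    ‖hcoef t k‖ ≤ ∑' n, ‖a n‖ := by
  rw [← (hasSum_hcoef ha h k).tsum_eq]
  refine tsum_of_norm_bounded ha.hasSum fun n => ?_
  split_ifs <;> simp

theorem RSummable.neg {R : ℝ} {t : ℕ → ℂ} (ht : RSummable R t) : RSummable R (-t) := by
  simpa [RSummable] using ht

theorem RSummable.summable_mul_pow {R : ℝ} (hR : 1 < R) {t : ℕ → ℂ} (ht : RSummable R t)
    {z : ℂ} (hz : ‖z‖ ≤ 1) : Summable fun n => t n * z ^ (n + 1) := by
  refine Summable.of_norm_bounded ht fun n => ?_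
  rw [norm_mul, norm_pow]
  gcongr
  exact hz.trans hR.le

theorem Jfun_eq_mul_gammaFn {R : ℝ} (hR : 1 < R) {t t' : ℕ → ℂ} (ht : RSummable R t)
    (ht' : RSummable R t') {z : ℂ} (hz : ‖z‖ = 1) :
    Jfun z t t' = gammaFn z t * gammaFn z⁻¹ (-t') := by
  rw [Jfun, gammaFn, gammaFn, ← Complex.exp_add,
    (ht.summable_mul_pow hR hz.le).tsum_sub
      (ht'.summable_mul_pow hR (z := z⁻¹) (by simp [hz]))]
  simp [tsum_neg, sub_eq_add_neg]

/-- `J_k(t,t') = ∑_{j ≥ 0} h_{k+j}(t) h_j(-t')`, the series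
converging absolutely. -/
theorem Jcoef_eq_tsum_hcoef (R : ℝ) (hR : 1 < R) (t t' : ℕ → ℂ)
    (ht : RSummable R t) (ht' : RSummable R t') (k : ℤ) :
    (Summable fun j : ℕ => ‖hcoef t (k + j)‖ * ‖hcoef (-t') (j : ℤ)‖) ∧
      Jcoef t t' k = ∑' j : ℕ, hcoef t (k + j) * hcoef (-t') (j : ℤ) := by
  obtain ⟨a, ha, hγ⟩ := exists_hasSum_gammaFn hR ht
  obtain ⟨b, hb, hγ'⟩ := exists_hasSum_gammaFn hR ht'.neg
  simp only [hcoef_natCast hb hγ']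
  refine ⟨Summable.of_nonneg_of_le (fun _ => by positivity)
    (fun j => mul_le_mul_of_nonneg_right (norm_hcoef_le ha hγ _) (norm_nonneg _))
    (hb.mul_left _), ?_⟩
  have hprod : Summable fun p : ℕ × ℕ => ‖a p.2 * b p.1‖ := by
    simpa only [norm_mul, mul_comm] using
      hb.mul_of_nonneg ha (fun _ => norm_nonneg _) fun _ => norm_nonneg _
  have hJ : HasSum (fun p : ℕ × ℕ => if (p.2 : ℤ) - p.1 = k then a p.2 * b p.1 else 0)
      (Jcoef t t' k) := by
    refine hasSum_fourierIntegral (fun p : ℕ × ℕ => (p.2 : ℤ) - p.1) hprod (fun θ => ?_) k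
    set z := Complex.exp (θ * Complex.I)
    have hz1 : ‖z‖ = 1 := Complex.norm_exp_ofReal_mul_I θ
    have hz0 : z ≠ 0 := Complex.exp_ne_zero _
    have hterm : (fun p : ℕ × ℕ => a p.2 * b p.1 * z ^ ((p.2 : ℤ) - p.1)) =
        fun p : ℕ × ℕ => (b p.1 * z⁻¹ ^ p.1) * (a p.2 * z ^ p.2) := by
      funext p
      rw [zpow_sub₀ hz0, zpow_natCast, zpow_natCast, inv_pow]
      ring
    have hsumm : Summable fun p : ℕ × ℕ => (b p.1 * z⁻¹ ^ p.1) * (a p.2 * z ^ p.2) := by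
      rw [← hterm]
      refine Summable.of_norm ?_
      simpa [hz1] using hprod
    rw [Jfun_eq_mul_gammaFn hR ht ht' hz1, mul_comm, hterm]
    exact HasSum.mul (f := fun j => b j * z⁻¹ ^ j) (g := fun i => a i * z ^ i)
      (hγ' z⁻¹ (by simp [hz1])) (hγ z hz1.le) hsumm
  refine (hJ.prod_fiberwise fun j => ?_).tsum_eq.symm
  convert! (hasSum_hcoef ha hγ (k + j)).mul_right (b j) using 2 with i
  simp only [ite_mul, zero_mul, sub_eq_iff_eq_add]

end
end

section
/- Let R > 1, let t, t' be R-summable sequences of complex numbers, let σ : ℤ' → [0,1] satisfy Σ_{k∈ℤ', k<0} σ(k) < ∞, and let n ∈ ℤ. Then the two Fredholm series below converge absolutely and are equal (an instance of det(1−AB) = det(1−BA)): Σ_{m≥0} ((−1)^m/m!) Σ_{x_1,...,x_m ∈ ℤ', x_i > n} det(K_{t,t',σ}(x_i,x_j))_{i,j=1}^m = Σ_{m≥0} ((−1)^m/m!) Σ_{x_1,...,x_m ∈ ℤ'} det(σ(x_i − n) · K_{t,t',1_{ℤ'_{>0}}}(x_j, x_i))_{i,j=1}^m. -/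
open scoped BigOperators

noncomputable section

theorem norm_det_le_prod_row_norm {m : ℕ} (A : Matrix (Fin m) (Fin m) ℂ) :
    ‖A.det‖ ≤ ∏ i, Real.sqrt (∑ j, ‖A i j‖ ^ 2) := by
  classical
  set v : Fin m → EuclideanSpace ℂ (Fin m) := fun i => WithLp.toLp 2 (A i) with hv
  have hcard : Module.finrank ℂ (EuclideanSpace ℂ (Fin m)) = Fintype.card (Fin m) := by simp
  set b := InnerProductSpace.gramSchmidtOrthonormalBasis hcard v
  set e := EuclideanSpace.basisFun (Fin m) ℂ
  have hdet : e.toBasis.det v = A.det := by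
    rw [Module.Basis.det_apply, ← Matrix.det_transpose]
    congr 1
  have hchange : e.toBasis.det v = e.toBasis.det b * b.toBasis.det v := by
    simpa using congrArg (fun f => f v) (AlternatingMap.eq_smul_basis_det b.toBasis e.toBasis.det)
  rw [← hdet, hchange, norm_mul, e.det_to_matrix_orthonormalBasis b, one_mul,
    InnerProductSpace.gramSchmidtOrthonormalBasis_det, norm_prod]
  refine Finset.prod_le_prod (fun _ _ => norm_nonneg _) fun i _ => ?_
  calc ‖inner ℂ (b i) (v i)‖ ≤ ‖b i‖ * ‖v i‖ := norm_inner_le_norm _ _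
    _ = Real.sqrt (∑ j, ‖A i j‖ ^ 2) := by
      rw [b.norm_eq_one, one_mul, EuclideanSpace.norm_eq]

theorem norm_det_le_of_norm_le_mul {m : ℕ} (A : Matrix (Fin m) (Fin m) ℂ) (p q : Fin m → ℝ)
    (hp : ∀ i, 0 ≤ p i) (hq : ∀ i, 0 ≤ q i) (h : ∀ i j, ‖A i j‖ ≤ p i * q j) :
    ‖A.det‖ ≤ Real.sqrt m ^ m * ∏ i, (p i * q i) := by
  by_cases hz : ∃ j, q j = 0
  · obtain ⟨j, hj⟩ := hz
    rw [Matrix.det_eq_zero_of_column_eq_zero j fun i => by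
      simpa [hj] using h i j, norm_zero]
    exact mul_nonneg (by positivity)
      (Finset.prod_nonneg fun i _ => mul_nonneg (hp i) (hq i))
  push Not at hz
  have hA : A = Matrix.of fun i j => (q j : ℂ) * (A i j / q j) := by
    ext i j
    have : (q j : ℂ) ≠ 0 := by exact_mod_cast hz j
    simp [mul_div_cancel₀, this]
  have hdet : A.det = (∏ j, (q j : ℂ)) * (Matrix.of fun i j => A i j / (q j : ℂ)).det := by
    conv_lhs => rw [hA]
    exact Matrix.det_mul_row (fun j => (q j : ℂ)) (Matrix.of fun i j => A i j / (q j : ℂ))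
  rw [hdet, norm_mul, norm_prod, Finset.prod_mul_distrib]
  have hB : ‖(Matrix.of fun i j => A i j / (q j : ℂ)).det‖ ≤ Real.sqrt m ^ m * ∏ i, p i := by
    refine (norm_det_le_prod_row_norm _).trans ?_
    have : ∏ i : Fin m, (Real.sqrt m * p i) = Real.sqrt m ^ m * ∏ i, p i := by
      simp [Finset.prod_mul_distrib]
    rw [← this]
    refine Finset.prod_le_prod (fun _ _ => Real.sqrt_nonneg _) fun i _ => ?_
    rw [Real.sqrt_le_left (mul_nonneg (Real.sqrt_nonneg _) (hp i)), mul_pow,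
      Real.sq_sqrt (by positivity)]
    refine (Finset.sum_le_card_nsmul _ _ (p i ^ 2) fun j _ => ?_).trans (by simp)
    have hqj : 0 < q j := lt_of_le_of_ne (hq j) (hz j).symm
    refine pow_le_pow_left₀ (norm_nonneg _) ?_ 2
    rw [Matrix.of_apply, norm_div, Complex.norm_real, Real.norm_of_nonneg (hq j), div_le_iff₀ hqj]
    exact h i j
  have hqn : ∏ i, ‖(q i : ℂ)‖ = ∏ i, q i :=
    Finset.prod_congr rfl fun i _ => by rw [Complex.norm_real, Real.norm_of_nonneg (hq i)]
  rw [hqn]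
  have := mul_le_mul_of_nonneg_left hB (Finset.prod_nonneg fun i (_ : i ∈ Finset.univ) => hq i)
  linarith

theorem summable_norm_prod_pi_and_prod_tsum {T 𝕜 : Type*} [NormedField 𝕜] [CompleteSpace 𝕜] :
    ∀ {m : ℕ} (f : Fin m → T → 𝕜), (∀ i, Summable fun c => ‖f i c‖) →
      (Summable fun c : Fin m → T => ‖∏ i, f i (c i)‖) ∧
        ∏ i, ∑' c, f i c = ∑' c : Fin m → T, ∏ i, f i (c i)
  | 0, f, _ => by
    refine ⟨(hasSum_fintype _).summable, ?_⟩
    rw [tsum_fintype]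
    simp
  | m + 1, f, hf => by
    obtain ⟨h1, h2⟩ := summable_norm_prod_pi_and_prod_tsum (fun i => f i.succ) fun i => hf i.succ
    constructor
    · rw [← (Fin.consEquiv fun _ => T).summable_iff]
      refine ((hf 0).mul_of_nonneg h1 (fun _ => norm_nonneg _) fun _ => norm_nonneg _).congr ?_
      intro x
      simp [Fin.consEquiv, Fin.prod_univ_succ]
    · rw [Fin.prod_univ_succ, h2, tsum_mul_tsum_of_summable_norm (hf 0) h1,
        ← (Fin.consEquiv fun _ => T).tsum_eq]
      refine tsum_congr fun x => ?_
      simp [Fin.consEquiv, Fin.prod_univ_succ]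

theorem summable_prod_pi {T : Type*} {m : ℕ} {g : T → ℝ}
    (hg : Summable g) :
    (Summable fun c : Fin m → T => ∏ i, g (c i)) ∧
      ∑' c : Fin m → T, ∏ i, g (c i) = (∑' c, g c) ^ m := by
  obtain ⟨h1, h2⟩ := summable_norm_prod_pi_and_prod_tsum (fun _ : Fin m => g)
    fun _ => hg.norm
  refine ⟨h1.of_norm, ?_⟩
  rw [← h2]
  simp

theorem summable_sqrt_pow_mul_pow_div_factorial (H : ℝ) (hH : 0 ≤ H) :
    Summable fun m : ℕ => (m.factorial : ℝ)⁻¹ * (Real.sqrt m ^ m * H ^ m) := by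
  have h1 : Summable fun m : ℕ => (4 * Real.exp 1 * H ^ 2) ^ m / m.factorial :=
    Real.summable_pow_div_factorial _
  have h2 : Summable fun m : ℕ => ((1 : ℝ) / 4) ^ m :=
    summable_geometric_of_lt_one (by norm_num) (by norm_num)
  refine Summable.of_nonneg_of_le (fun m => by positivity) (fun m => ?_) (h1.add h2)
  set x := (m.factorial : ℝ)⁻¹ * (Real.sqrt m ^ m * H ^ m) with hx
  have hx0 : 0 ≤ x := by positivity
  have hsq : x ^ 2 ≤ Real.exp 1 ^ m * (H ^ 2) ^ m / m.factorial := by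
    have hm := Real.pow_div_factorial_le_exp (m : ℝ) (by positivity) m
    have hs : (Real.sqrt m ^ m) ^ 2 = (m : ℝ) ^ m := by
      rw [← pow_mul, mul_comm, pow_mul, Real.sq_sqrt (by positivity)]
    have : x ^ 2 = ((m : ℝ) ^ m / m.factorial) * ((H ^ 2) ^ m / m.factorial) := by
      rw [hx, mul_pow, mul_pow, hs]
      field_simp
      ring
    rw [this, ← Real.exp_nat_mul, mul_one, mul_div_assoc]
    gcongr
  have key : x ≤ 4 ^ m * x ^ 2 + (1 / 4 : ℝ) ^ m := by
    have h4 : (4 : ℝ) ^ m = (2 ^ m) ^ 2 := by rw [← pow_mul, mul_comm, pow_mul]; norm_num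
    have h5 : (1 / 4 : ℝ) ^ m = ((1 / 2) ^ m) ^ 2 := by
      rw [← pow_mul, mul_comm, pow_mul]; norm_num
    have h6 : (2 : ℝ) ^ m * (1 / 2) ^ m = 1 := by rw [← mul_pow]; norm_num
    rw [h4, h5]
    nlinarith [sq_nonneg (2 ^ m * x - (1 / 2) ^ m), sq_nonneg ((2 : ℝ) ^ m * x),
      sq_nonneg ((1 / 2 : ℝ) ^ m)]
  refine key.trans (add_le_add_left ?_ _)
  calc (4 : ℝ) ^ m * x ^ 2 ≤ 4 ^ m * (Real.exp 1 ^ m * (H ^ 2) ^ m / m.factorial) := by gcongr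
    _ = _ := by rw [mul_pow, mul_pow]; ring

theorem fredholm_summable_of_norm_le_mul {T : Type*} (K : T → T → ℂ) (p q : T → ℝ)
    (hp : ∀ i, 0 ≤ p i) (hq : ∀ i, 0 ≤ q i) (h : ∀ a b, ‖K a b‖ ≤ p a * q b)
    (hpq : Summable fun a => p a * q a) :
    (∀ m : ℕ, Summable fun x : Fin m → T =>
        ‖Matrix.det (Matrix.of fun i j : Fin m => K (x i) (x j))‖) ∧
      Summable fun m : ℕ => (m.factorial : ℝ)⁻¹ *
        ∑' x : Fin m → T, ‖Matrix.det (Matrix.of fun i j : Fin m => K (x i) (x j))‖ := by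
  have hpq0 : ∀ a, 0 ≤ p a * q a := fun a => mul_nonneg (hp a) (hq a)
  have hb : ∀ (m : ℕ) (x : Fin m → T),
      ‖Matrix.det (Matrix.of fun i j : Fin m => K (x i) (x j))‖
        ≤ Real.sqrt m ^ m * ∏ i, (p (x i) * q (x i)) := fun m x =>
    norm_det_le_of_norm_le_mul _ (fun i => p (x i)) (fun i => q (x i)) (fun _ => hp _)
      (fun _ => hq _) fun _ _ => h _ _
  have hs : ∀ m : ℕ, Summable fun x : Fin m → T => Real.sqrt m ^ m * ∏ i, (p (x i) * q (x i)) :=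
    fun m => (summable_prod_pi hpq).1.mul_left _
  have hd := fun m : ℕ =>
    Summable.of_nonneg_of_le (fun _ => norm_nonneg _) (hb m) (hs m)
  refine ⟨hd, Summable.of_nonneg_of_le
    (fun m => mul_nonneg (by positivity) (tsum_nonneg fun _ => norm_nonneg _)) (fun m => ?_)
    (summable_sqrt_pow_mul_pow_div_factorial (∑' a, p a * q a) (tsum_nonneg hpq0))⟩
  refine mul_le_mul_of_nonneg_left ?_ (by positivity)
  rw [← (summable_prod_pi hpq).2, ← tsum_mul_left]
  exact (hd m).tsum_le_tsum (hb m) (hs m)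

/-- Cauchy–Schwarz for the pairing of two series with nonnegative weights. -/
theorem weighted_cauchy_schwarz_tsum {T : Type*} (s f g : T → ℝ) (hs : ∀ c, 0 ≤ s c)
    (hf : ∀ c, 0 ≤ f c) (hg : ∀ c, 0 ≤ g c)
    (hfs : Summable fun c => s c * f c ^ 2) (hgs : Summable fun c => s c * g c ^ 2) :
    (Summable fun c => s c * f c * g c) ∧
      ∑' c, s c * f c * g c
        ≤ Real.sqrt (∑' c, s c * f c ^ 2) * Real.sqrt (∑' c, s c * g c ^ 2) := by
  have hsq : ∀ (u : T → ℝ) (c : T), (Real.sqrt (s c) * u c) ^ (2 : ℝ) = s c * u c ^ 2 := by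
    intro u c
    rw [Real.rpow_two, mul_pow, Real.sq_sqrt (hs c)]
  have hmul : ∀ c, Real.sqrt (s c) * f c * (Real.sqrt (s c) * g c) = s c * f c * g c := by
    intro c
    linear_combination (f c * g c) * Real.mul_self_sqrt (hs c)
  have := Real.summable_and_inner_le_Lp_mul_Lq_tsum_of_nonneg (p := 2) (q := 2)
    (f := fun c => Real.sqrt (s c) * f c) (g := fun c => Real.sqrt (s c) * g c)
    Real.HolderConjugate.two_two
    (fun c => mul_nonneg (Real.sqrt_nonneg _) (hf c))
    (fun c => mul_nonneg (Real.sqrt_nonneg _) (hg c))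
    (by simpa only [hsq] using hfs) (by simpa only [hsq] using hgs)
  simpa only [hsq, hmul, ← Real.sqrt_eq_rpow] using this

theorem tsum_det_comm {S T : Type*} (Q : S → T → ℂ) (P : T → S → ℂ) (m : ℕ)
    (hQP : ∀ a b, Summable fun c => ‖Q a c * P c b‖)
    (hPQ : ∀ c d, Summable fun a => ‖P c a * Q a d‖)
    (hsum : ∀ π : Equiv.Perm (Fin m), Summable fun z : (Fin m → S) × (Fin m → T) =>
      ‖∏ i, Q (z.1 i) (z.2 i) * P (z.2 (π i)) (z.1 i)‖) :
    ∑' x : Fin m → S, Matrix.det (Matrix.of fun i j => ∑' c, Q (x i) c * P c (x j))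
      = ∑' y : Fin m → T, Matrix.det (Matrix.of fun i j => ∑' a, P (y i) a * Q a (y j)) := by
  set t : Equiv.Perm (Fin m) → (Fin m → S) → (Fin m → T) → ℂ :=
    fun π x y => ∏ i, Q (x i) (y i) * P (y (π i)) (x i) with ht
  have hts : ∀ π, Summable (Function.uncurry (t π)) := fun π => (hsum π).of_norm
  have hL : ∀ (π : Equiv.Perm (Fin m)) (x : Fin m → S),
      ∏ i, ∑' c, Q (x (π i)) c * P c (x i) = ∑' y, t π (x ∘ π) y := by
    intro π x
    rw [(summable_norm_prod_pi_and_prod_tsum (fun i c => Q (x (π i)) c * P c (x i))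
      fun i => hQP _ _).2]
    refine tsum_congr fun y => ?_
    simp only [ht, Finset.prod_mul_distrib, Function.comp]
    congr 1
    exact (Equiv.prod_comp π fun i => P (y i) (x i)).symm
  have hR : ∀ (π : Equiv.Perm (Fin m)) (y : Fin m → T),
      ∏ i, ∑' a, P (y (π i)) a * Q a (y i) = ∑' x, t π x y := by
    intro π y
    rw [(summable_norm_prod_pi_and_prod_tsum (fun i a => P (y (π i)) a * Q a (y i))
      fun i => hPQ _ _).2]
    exact tsum_congr fun x => Finset.prod_congr rfl fun i _ => mul_comm _ _
  have hLs : ∀ π : Equiv.Perm (Fin m), Summable fun x : Fin m → S => ∑' y, t π (x ∘ π) y := by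
    intro π
    have := (hts π).prod
    exact this.comp_injective (i := fun x : Fin m → S => x ∘ π)
      (fun x x' h => π.surjective.injective_comp_right h)
  have hRs : ∀ π : Equiv.Perm (Fin m), Summable fun y : Fin m → T => ∑' x, t π x y :=
    fun π => (hts π).prod_symm.prod
  simp only [Matrix.det_apply', Matrix.of_apply, hL, hR]
  rw [Summable.tsum_finsetSum fun π _ => (hLs π).mul_left _,
    Summable.tsum_finsetSum fun π _ => (hRs π).mul_left _]
  refine Finset.sum_congr rfl fun π _ => ?_
  rw [tsum_mul_left, tsum_mul_left, (hts π).tsum_comm]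
  congr 1
  exact (Equiv.arrowCongr π.symm (Equiv.refl S)).tsum_eq fun x => ∑' y, t π x y

/-- `det (1 - QP) = det (1 - PQ)` at the level of Fredholm series, for kernels dominated by a
weighted Hilbert–Schmidt kernel. -/
theorem fredholm_comm_of_dominated {S T : Type*} (Q : S → T → ℂ) (P : T → S → ℂ)
    (s : T → ℝ) (F : S → T → ℝ) (hs : ∀ c, 0 ≤ s c) (hF : ∀ a c, 0 ≤ F a c)
    (hQ : ∀ a c, ‖Q a c‖ ≤ F a c) (hP : ∀ c a, ‖P c a‖ ≤ s c * F a c)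
    (hsum : Summable fun z : S × T => s z.2 * F z.1 z.2 ^ 2)
    (hcol : ∀ c, Summable fun a => F a c ^ 2) :
    ((∀ m : ℕ, Summable fun x : Fin m → S =>
        ‖Matrix.det (Matrix.of fun i j => ∑' c, Q (x i) c * P c (x j))‖) ∧
      Summable fun m : ℕ => (m.factorial : ℝ)⁻¹ *
        ∑' x : Fin m → S, ‖Matrix.det (Matrix.of fun i j => ∑' c, Q (x i) c * P c (x j))‖) ∧
    ((∀ m : ℕ, Summable fun y : Fin m → T =>
        ‖Matrix.det (Matrix.of fun i j => ∑' a, P (y i) a * Q a (y j))‖) ∧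
      Summable fun m : ℕ => (m.factorial : ℝ)⁻¹ *
        ∑' y : Fin m → T, ‖Matrix.det (Matrix.of fun i j => ∑' a, P (y i) a * Q a (y j))‖) ∧
    ∀ m : ℕ,
      ∑' x : Fin m → S, Matrix.det (Matrix.of fun i j => ∑' c, Q (x i) c * P c (x j))
        = ∑' y : Fin m → T, Matrix.det (Matrix.of fun i j => ∑' a, P (y i) a * Q a (y j)) := by
  have hrow : ∀ a, Summable fun c => s c * F a c ^ 2 := fun a => hsum.prod_factor a
  have hQPb : ∀ a b c, ‖Q a c * P c b‖ ≤ s c * F a c * F b c := fun a b c => by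
    rw [norm_mul]
    calc ‖Q a c‖ * ‖P c b‖ ≤ F a c * (s c * F b c) :=
          mul_le_mul (hQ a c) (hP c b) (norm_nonneg _) (hF a c)
      _ = _ := by ring
  have hPQb : ∀ c d a, ‖P c a * Q a d‖ ≤ s c * (1 * F a c * F a d) := fun c d a => by
    rw [norm_mul]
    calc ‖P c a‖ * ‖Q a d‖ ≤ (s c * F a c) * F a d :=
          mul_le_mul (hP c a) (hQ a d) (norm_nonneg _) (mul_nonneg (hs c) (hF a c))
      _ = _ := by ring
  have hcsQP := fun a b => weighted_cauchy_schwarz_tsum s (F a) (F b) hs (hF a) (hF b)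
    (hrow a) (hrow b)
  have hcsPQ := fun c d => weighted_cauchy_schwarz_tsum (fun _ : S => (1 : ℝ)) (fun a => F a c)
    (fun a => F a d) (fun _ => zero_le_one) (fun a => hF a c) (fun a => hF a d)
    (by simpa using hcol c) (by simpa using hcol d)
  have hQPs : ∀ a b, Summable fun c => ‖Q a c * P c b‖ := fun a b =>
    Summable.of_nonneg_of_le (fun _ => norm_nonneg _) (hQPb a b) (hcsQP a b).1
  have hPQs : ∀ c d, Summable fun a => ‖P c a * Q a d‖ := fun c d =>
    Summable.of_nonneg_of_le (fun _ => norm_nonneg _) (hPQb c d) ((hcsPQ c d).1.mul_left _)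
  have hmsum : ∀ a, 0 ≤ ∑' c, s c * F a c ^ 2 := fun a =>
    tsum_nonneg fun c => mul_nonneg (hs c) (sq_nonneg _)
  have hcsum : ∀ c, 0 ≤ ∑' a, F a c ^ 2 := fun c => tsum_nonneg fun a => sq_nonneg _
  refine ⟨?_, ?_, fun m => tsum_det_comm Q P m hQPs hPQs fun π => ?_⟩
  · refine fredholm_summable_of_norm_le_mul (fun a b => ∑' c, Q a c * P c b)
      (fun a => Real.sqrt (∑' c, s c * F a c ^ 2)) (fun a => Real.sqrt (∑' c, s c * F a c ^ 2))
      (fun _ => Real.sqrt_nonneg _) (fun _ => Real.sqrt_nonneg _) (fun a b => ?_) ?_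
    · exact (norm_tsum_le_tsum_norm (hQPs a b)).trans
        (((hQPs a b).tsum_le_tsum (hQPb a b) (hcsQP a b).1).trans (hcsQP a b).2)
    · simpa only [Real.mul_self_sqrt (hmsum _)] using hsum.prod
  · refine fredholm_summable_of_norm_le_mul (fun c d => ∑' a, P c a * Q a d)
      (fun c => s c * Real.sqrt (∑' a, F a c ^ 2)) (fun c => Real.sqrt (∑' a, F a c ^ 2))
      (fun c => mul_nonneg (hs c) (Real.sqrt_nonneg _)) (fun _ => Real.sqrt_nonneg _)
      (fun c d => ?_) ?_
    · refine (norm_tsum_le_tsum_norm (hPQs c d)).trans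
        (((hPQs c d).tsum_le_tsum (hPQb c d) ((hcsPQ c d).1.mul_left _)).trans ?_)
      rw [tsum_mul_left, mul_assoc]
      exact mul_le_mul_of_nonneg_left (by simpa only [one_mul] using (hcsPQ c d).2) (hs c)
    · simpa only [mul_assoc, Real.mul_self_sqrt (hcsum _), one_mul, Prod.swap, tsum_mul_left]
        using hsum.prod_symm.prod
  · have hG := (summable_prod_pi (m := m) hsum).1
    have hG1 : Summable fun z : (Fin m → S) × (Fin m → T) =>
        ∏ i, (s (z.2 i) * F (z.1 i) (z.2 i) ^ 2) :=
      ((Equiv.arrowProdEquivProdArrow (Fin m) (fun _ => S) fun _ => T).symm.summable_iff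
        (f := fun w : Fin m → S × T => ∏ i, (s (w i).2 * F (w i).1 (w i).2 ^ 2))).mpr hG
    have hG2 : Summable fun z : (Fin m → S) × (Fin m → T) =>
        ∏ i, (s (z.2 (π i)) * F (z.1 i) (z.2 (π i)) ^ 2) :=
      hG1.comp_injective
        (i := fun z : (Fin m → S) × (Fin m → T) => (z.1, z.2 ∘ π)) fun z z' h => by
          have h1 := (Prod.mk.inj h).1
          have h2 := (Prod.mk.inj h).2
          exact Prod.ext h1 (π.surjective.injective_comp_right h2)
    refine Summable.of_nonneg_of_le (fun _ => norm_nonneg _) (fun z => ?_) (hG1.add hG2)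
    rw [norm_prod]
    set u := ∏ i, (Real.sqrt (s (z.2 i)) * F (z.1 i) (z.2 i)) with hu
    set v := ∏ i, (Real.sqrt (s (z.2 (π i))) * F (z.1 i) (z.2 (π i))) with hv
    have hle : ∏ i, ‖Q (z.1 i) (z.2 i) * P (z.2 (π i)) (z.1 i)‖ ≤ u * v := by
      have hperm : ∏ i, Real.sqrt (s (z.2 (π i))) = ∏ i, Real.sqrt (s (z.2 i)) :=
        Equiv.prod_comp π fun i => Real.sqrt (s (z.2 i))
      have hsq : ∏ i, s (z.2 (π i))
          = (∏ i, Real.sqrt (s (z.2 (π i)))) * ∏ i, Real.sqrt (s (z.2 (π i))) := by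
        rw [← Finset.prod_mul_distrib]
        exact Finset.prod_congr rfl fun i _ => (Real.mul_self_sqrt (hs _)).symm
      calc _ ≤ ∏ i, (F (z.1 i) (z.2 i) * (s (z.2 (π i)) * F (z.1 i) (z.2 (π i)))) := by
            refine Finset.prod_le_prod (fun _ _ => norm_nonneg _) fun i _ => ?_
            rw [norm_mul]
            exact mul_le_mul (hQ _ _) (hP _ _) (norm_nonneg _) (hF _ _)
        _ = u * v := by
            simp only [hu, hv, Finset.prod_mul_distrib]
            rw [hsq, hperm]
            ring
    have hu2 : u ^ 2 = ∏ i, (s (z.2 i) * F (z.1 i) (z.2 i) ^ 2) := by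
      rw [hu, ← Finset.prod_pow]
      exact Finset.prod_congr rfl fun i _ => by rw [mul_pow, Real.sq_sqrt (hs _)]
    have hv2 : v ^ 2 = ∏ i, (s (z.2 (π i)) * F (z.1 i) (z.2 (π i)) ^ 2) := by
      rw [hv, ← Finset.prod_pow]
      exact Finset.prod_congr rfl fun i _ => by rw [mul_pow, Real.sq_sqrt (hs _)]
    rw [← hu2, ← hv2]
    nlinarith [sq_nonneg (u - v), sq_nonneg u, sq_nonneg v]

theorem norm_Jfun_term_le {R : ℝ} (t t' : ℕ → ℂ) {z : ℂ} (h1 : ‖z‖ ≤ R)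
    (h2 : ‖z⁻¹‖ ≤ R) (n : ℕ) :
    ‖t n * z ^ (n + 1) - t' n * z⁻¹ ^ (n + 1)‖
      ≤ ‖t n‖ * R ^ (n + 1) + ‖t' n‖ * R ^ (n + 1) := by
  refine (norm_sub_le _ _).trans ?_
  rw [norm_mul, norm_mul, norm_pow, norm_pow]
  gcongr

/-- A bound for `J(·;t,t')` on the annulus `1/R ≤ |z| ≤ R`. -/
def Jbound (R : ℝ) (t t' : ℕ → ℂ) : ℝ :=
  Real.exp (∑' n : ℕ, (‖t n‖ * R ^ (n + 1) + ‖t' n‖ * R ^ (n + 1)))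

theorem norm_Jfun_le {R : ℝ} {t t' : ℕ → ℂ} (ht : RSummable R t) (ht' : RSummable R t')
    {z : ℂ} (h1 : ‖z‖ ≤ R) (h2 : ‖z⁻¹‖ ≤ R) : ‖Jfun z t t'‖ ≤ Jbound R t t' := by
  have hs := ht.add ht'
  rw [Jfun, Complex.norm_exp, Jbound]
  refine Real.exp_le_exp.mpr ((Complex.re_le_norm _).trans ?_)
  exact tsum_of_norm_bounded hs.hasSum fun n => norm_Jfun_term_le t t' h1 h2 n

theorem differentiableAt_Jfun {R : ℝ} {t t' : ℕ → ℂ}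
    (ht : RSummable R t) (ht' : RSummable R t') {z : ℂ} (hz : z ≠ 0) (h1 : ‖z‖ < R)
    (h2 : ‖z⁻¹‖ < R) : DifferentiableAt ℂ (fun w => Jfun w t t') z := by
  have hc : ContinuousOn (fun w : ℂ => ‖w⁻¹‖) {w | w ≠ 0} :=
    (continuousOn_inv₀).norm
  have hU : IsOpen ({w : ℂ | w ≠ 0} ∩ (fun w => ‖w⁻¹‖) ⁻¹' Set.Iio R ∩ {w | ‖w‖ < R}) :=
    (hc.isOpen_inter_preimage isOpen_ne isOpen_Iio).inter
      (isOpen_lt continuous_norm continuous_const)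
  have hd := Complex.differentiableOn_tsum_of_summable_norm (ht.add ht')
    (F := fun n w => t n * w ^ (n + 1) - t' n * w⁻¹ ^ (n + 1))
    (fun n w hw => by
      have hw0 : w ≠ 0 := hw.1.1
      refine DifferentiableAt.differentiableWithinAt ?_
      fun_prop (disch := assumption)) hU
    (fun n w hw => norm_Jfun_term_le t t' (le_of_lt hw.2) (le_of_lt hw.1.2) n)
  exact (hd.differentiableAt (hU.mem_nhds ⟨⟨hz, h2⟩, h1⟩)).cexp

theorem Jcoef_eq_circleIntegral (t t' : ℕ → ℂ) (k : ℤ) :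
    Jcoef t t' k = (2 * Real.pi * Complex.I : ℂ)⁻¹ •
      ∮ z in C(0, 1), (z - 0)⁻¹ • (Jfun z t t' * z ^ (-k)) := by
  rw [Jcoef, circleIntegral, mul_inv _ Complex.I, mul_smul, smul_eq_mul, smul_eq_mul,
    ← intervalIntegral.integral_const_mul Complex.I⁻¹]
  congr 1
  refine intervalIntegral.integral_congr fun θ _ => ?_
  have h1 : circleMap 0 1 θ = Complex.exp (θ * Complex.I) := by simp [circleMap]
  have h2 : Complex.exp (θ * Complex.I) ^ (-k) = Complex.exp (-(k : ℂ) * θ * Complex.I) := by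
    rw [← Complex.exp_int_mul]
    congr 1
    push_cast
    ring
  simp only [deriv_circleMap, h1, h2, smul_eq_mul, sub_zero]
  field_simp [Complex.exp_ne_zero, Complex.I_ne_zero]

theorem norm_Jcoef_le_of_radius {R ρ : ℝ} {t t' : ℕ → ℂ}
    (ht : RSummable R t) (ht' : RSummable R t') (hρ0 : 0 < ρ) (hR : 1 < R) (h1 : ρ < R)
    (h2 : ρ⁻¹ < R) (k : ℤ) : ‖Jcoef t t' k‖ ≤ Jbound R t t' * ρ ^ (-k) := by
  have hdiff : ∀ z : ℂ, z ≠ 0 → ‖z‖ < R → ‖z⁻¹‖ < R →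
      DifferentiableAt ℂ (fun z => Jfun z t t' * z ^ (-k)) z := fun z hz hz1 hz2 =>
    (differentiableAt_Jfun ht ht' hz hz1 hz2).mul (differentiableAt_zpow.mpr (Or.inl hz))
  have hshift : ∀ a b : ℝ, 0 < a → a ≤ b → b < R → a⁻¹ < R →
      ∮ z in C(0, b), (z - 0)⁻¹ • (Jfun z t t' * z ^ (-k))
        = ∮ z in C(0, a), (z - 0)⁻¹ • (Jfun z t t' * z ^ (-k)) := by
    intro a b ha hab hb ha'
    have hd : ∀ z : ℂ, a ≤ ‖z‖ → ‖z‖ ≤ b →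
        DifferentiableAt ℂ (fun z => Jfun z t t' * z ^ (-k)) z := fun z hza hzb =>
      hdiff z (norm_pos_iff.mp (ha.trans_le hza)) (hzb.trans_lt hb) (by
        rw [norm_inv]
        exact (inv_anti₀ ha hza).trans_lt ha')
    refine Complex.circleIntegral_sub_center_inv_smul_eq_of_differentiable_on_annulus_off_countable
      ha hab Set.countable_empty (fun z hz => ?_) fun z hz => ?_
    · refine (hd z ?_ ?_).continuousAt.continuousWithinAt
      · simpa using hz.2
      · simpa using hz.1
    · refine hd z (le_of_lt ?_) (le_of_lt ?_)
      · simpa using hz.1.2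
      · simpa using hz.1.1
  have heq : ∮ z in C(0, 1), (z - 0)⁻¹ • (Jfun z t t' * z ^ (-k))
      = ∮ z in C(0, ρ), (z - 0)⁻¹ • (Jfun z t t' * z ^ (-k)) := by
    rcases le_total ρ 1 with h | h
    · exact hshift ρ 1 hρ0 h hR h2
    · exact (hshift 1 ρ one_pos h h1 (by simpa using hR)).symm
  rw [Jcoef_eq_circleIntegral, heq]
  refine (circleIntegral.norm_two_pi_i_inv_smul_integral_le_of_norm_le_const hρ0.le
    (C := ρ⁻¹ * (Jbound R t t' * ρ ^ (-k))) fun z hz => ?_).trans_eq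
    (mul_inv_cancel_left₀ hρ0.ne' _)
  have hzn : ‖z‖ = ρ := by simpa using hz
  rw [norm_smul, norm_mul, sub_zero, norm_inv, norm_zpow, hzn]
  gcongr
  exact norm_Jfun_le ht ht' (hzn ▸ h1.le) (by rw [norm_inv, hzn]; exact h2.le)

theorem norm_Jcoef_le {R r : ℝ} {t t' : ℕ → ℂ} (ht : RSummable R t) (ht' : RSummable R t')
    (hr : 1 < r) (hrR : r < R) (k : ℤ) :
    ‖Jcoef t t' k‖ ≤ Jbound R t t' * r⁻¹ ^ k.natAbs := by
  have hr0 : 0 < r := one_pos.trans hr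
  have hinv : r⁻¹ < R := (inv_lt_one_of_one_lt₀ hr).trans (hr.trans hrR)
  rcases Int.natAbs_eq k with hk | hk
  · refine (norm_Jcoef_le_of_radius ht ht' hr0 (hr.trans hrR) hrR hinv k).trans_eq ?_
    conv_lhs => rw [hk]
    rw [zpow_neg, zpow_natCast, inv_pow]
  · refine (norm_Jcoef_le_of_radius ht ht' (inv_pos.mpr hr0) (hr.trans hrR) hinv
      (by simpa using hrR) k).trans_eq ?_
    conv_lhs => rw [hk]
    rw [neg_neg, zpow_natCast]

theorem summable_pow_natAbs {q : ℝ} (hq0 : 0 ≤ q) (hq1 : q < 1) :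
    Summable fun k : ℤ => q ^ k.natAbs := by
  have h := summable_geometric_of_lt_one hq0 hq1
  exact Summable.of_nat_of_neg (by simpa using h) (by simpa using h)

theorem summable_weight_mul_pow_natAbs {q : ℝ} (hq0 : 0 < q) (hq1 : q < 1) (σ : ℤ → ℝ)
    (hσ01 : ∀ k, σ k ∈ Set.Icc (0 : ℝ) 1) (hσsum : Summable fun k : {k : ℤ // k < 0} => σ k)
    (n : ℤ) :
    Summable fun z : {a : ℤ // n ≤ a} × ℤ => σ z.2 * q ^ ((z.1 : ℤ) + z.2 + 1).natAbs := by
  have hq := summable_pow_natAbs hq0.le hq1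
  have hneg : Summable fun c : ℤ => {k : ℤ | k < 0}.indicator σ c :=
    summable_subtype_iff_indicator.mp hσsum
  have hneg0 : ∀ c, 0 ≤ {k : ℤ | k < 0}.indicator σ c := fun c =>
    Set.indicator_nonneg (fun k _ => (hσ01 k).1) c
  have h1 : Summable fun z : {a : ℤ // n ≤ a} × ℤ =>
      q ^ ((z.1 : ℤ) + z.2 + 1).natAbs * {k : ℤ | k < 0}.indicator σ z.2 :=
    (hq.mul_of_nonneg hneg (fun _ => by positivity) hneg0).comp_injective
      (i := fun z : {a : ℤ // n ≤ a} × ℤ => ((z.1 : ℤ) + z.2 + 1, z.2)) fun z w h => by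
        obtain ⟨h1, h2⟩ := Prod.mk.inj h
        exact Prod.ext (Subtype.ext (by omega)) h2
  have h2 : Summable fun z : {a : ℤ // n ≤ a} × ℤ =>
      (q ^ (2 * n.natAbs))⁻¹ * (q ^ (z.1 : ℤ).natAbs * q ^ z.2.natAbs) :=
    ((hq.mul_of_nonneg hq (fun _ => by positivity) (fun _ => by positivity)).comp_injective
      (i := fun z : {a : ℤ // n ≤ a} × ℤ => ((z.1 : ℤ), z.2)) fun z w h => by
        obtain ⟨h1, h2⟩ := Prod.mk.inj h
        exact Prod.ext (Subtype.ext h1) h2).mul_left _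
  refine Summable.of_nonneg_of_le (fun z => mul_nonneg (hσ01 _).1 (by positivity))
    (fun z => ?_) (h1.add h2)
  obtain ⟨⟨a, ha⟩, c⟩ := z
  by_cases hc : c < 0
  · have : {k : ℤ | k < 0}.indicator σ c = σ c :=
      Set.indicator_of_mem (s := {k : ℤ | k < 0}) (a := c) hc σ
    simp only [this]
    rw [mul_comm]
    exact le_add_of_nonneg_right (by positivity)
  · refine le_trans ?_ (le_add_of_nonneg_left (mul_nonneg (by positivity) (hneg0 c)))
    simp only
    rw [← pow_add, le_inv_mul_iff₀ (by positivity)]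
    calc q ^ (2 * n.natAbs) * (σ c * q ^ (a + c + 1).natAbs)
        ≤ q ^ (2 * n.natAbs) * (1 * q ^ (a + c + 1).natAbs) := by
          gcongr
          exact (hσ01 c).2
      _ = q ^ (2 * n.natAbs + (a + c + 1).natAbs) := by rw [one_mul, pow_add]
      _ ≤ q ^ (a.natAbs + c.natAbs) := pow_le_pow_of_le_one hq0.le hq1.le (by omega)

theorem Kker_eq_tsum_shift (t t' : ℕ → ℂ) (σ : ℤ → ℝ) (n a b : ℤ) :
    Kker t t' σ a b = ∑' x : ℤ, Jcoef t t' (a + (x - n) + 1) *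
      ((σ (x - n) : ℂ) * Jcoef (-t) (-t') (-(b + (x - n) + 1))) := by
  rw [Kker, ← (Equiv.subRight n).tsum_eq]
  exact tsum_congr fun x => by simp only [Equiv.subRight_apply]; ring

theorem Kker_posInd_eq_tsum (t t' : ℕ → ℂ) (n x y : ℤ) :
    Kker t t' posInd y x = ∑' a : {a : ℤ // n ≤ a}, Jcoef t t' (a + (y - n) + 1) *
      Jcoef (-t) (-t') (-(a + (x - n) + 1)) := by
  rw [Kker, ← (Equiv.subRight n).tsum_eq, show (∑' a : {a : ℤ // n ≤ a},
    Jcoef t t' (a + (y - n) + 1) * Jcoef (-t) (-t') (-(a + (x - n) + 1))) = _ from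
    tsum_subtype {a : ℤ | n ≤ a} fun a => Jcoef t t' (a + (y - n) + 1) *
      Jcoef (-t) (-t') (-(a + (x - n) + 1))]
  refine tsum_congr fun a => ?_
  simp only [Equiv.subRight_apply, posInd, Set.indicator, Set.mem_ofPred_eq, sub_nonneg]
  split_ifs
  · rw [show y + (a - n) + 1 = a + (y - n) + 1 by ring,
      show x + (a - n) + 1 = a + (x - n) + 1 by ring]
    simp
  · simp

/-- `det(1-AB) = det(1-BA)` for the Fredholm series: the Fredholm
series of `K_{t,t',σ}` over `ℤ' ∩ (n,∞)` and the Fredholm series over all of `ℤ'`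
of the kernel `(x,y) ↦ σ(x−n) K_{t,t',1_{ℤ'_{>0}}}(y,x)` both converge absolutely
and are equal. -/
theorem fredholm_series_switch (R : ℝ) (hR : 1 < R) (t t' : ℕ → ℂ)
    (ht : RSummable R t) (ht' : RSummable R t')
    (σ : ℤ → ℝ) (hσ01 : ∀ k, σ k ∈ Set.Icc (0:ℝ) 1)
    (hσsum : Summable fun k : {k : ℤ // k < 0} => σ k)
    (n : ℤ) :
    FredholmAbsConv (Kker t t' σ) n ∧
      (∀ m : ℕ, Summable fun x : Fin m → ℤ =>
          ‖Matrix.det (Matrix.of fun i j : Fin m =>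
            (σ (x i - n) : ℂ) * Kker t t' posInd (x j) (x i))‖) ∧
      (Summable fun m : ℕ => (m.factorial : ℝ)⁻¹ *
          ∑' x : Fin m → ℤ,
            ‖Matrix.det (Matrix.of fun i j : Fin m =>
              (σ (x i - n) : ℂ) * Kker t t' posInd (x j) (x i))‖) ∧
      fredholmSeries (Kker t t' σ) n
        = ∑' m : ℕ, ((-1 : ℂ) ^ m / m.factorial) *
            ∑' x : Fin m → ℤ,
              Matrix.det (Matrix.of fun i j : Fin m =>
                (σ (x i - n) : ℂ) * Kker t t' posInd (x j) (x i)) := by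
  obtain ⟨r, hr, hrR⟩ := exists_between hR
  have hr0 : 0 < r := one_pos.trans hr
  have hq0 : 0 < r⁻¹ ^ 2 := by positivity
  have hq1 : r⁻¹ ^ 2 < 1 := pow_lt_one₀ (by positivity) (inv_lt_one_of_one_lt₀ hr) two_ne_zero
  have hneg : ∀ u : ℕ → ℂ, RSummable R u → RSummable R (-u) := fun u hu => by
    simpa [RSummable] using hu
  have hM : Jbound R (-t) (-t') = Jbound R t t' := by simp [Jbound]
  set M := Jbound R t t'
  have hM0 : 0 ≤ M := (Real.exp_pos _).le
  have hJ := fun k => norm_Jcoef_le ht ht' hr hrR k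
  have hJ' : ∀ k : ℤ, ‖Jcoef (-t) (-t') (-k)‖ ≤ M * r⁻¹ ^ k.natAbs := fun k => by
    simpa [hM] using norm_Jcoef_le (hneg t ht) (hneg t' ht') hr hrR (-k)
  have hpow : ∀ k : ℤ, (M * r⁻¹ ^ k.natAbs) ^ 2 = M ^ 2 * (r⁻¹ ^ 2) ^ k.natAbs := fun k => by
    rw [mul_pow, ← pow_mul, ← pow_mul, mul_comm 2]
  have hσn : ∀ c, ‖((σ c : ℝ) : ℂ)‖ = σ c := fun c => by
    rw [Complex.norm_real, Real.norm_of_nonneg (hσ01 c).1]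
  obtain ⟨hleft, hright, heq⟩ := fredholm_comm_of_dominated
    (S := {a : ℤ // n ≤ a}) (T := ℤ)
    (fun a x => Jcoef t t' (a + (x - n) + 1))
    (fun x a => (σ (x - n) : ℂ) * Jcoef (-t) (-t') (-(a + (x - n) + 1)))
    (fun x => σ (x - n)) (fun a x => M * r⁻¹ ^ ((a : ℤ) + (x - n) + 1).natAbs)
    (fun x => (hσ01 _).1) (fun a x => by positivity) (fun a x => hJ _)
    (fun x a => by
      rw [norm_mul, hσn]
      exact mul_le_mul_of_nonneg_left (hJ' _) (hσ01 _).1)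
    (by
      have h := ((summable_weight_mul_pow_natAbs hq0 hq1 σ hσ01 hσsum n).mul_left
        (M ^ 2)).comp_injective
        (i := fun z : {a : ℤ // n ≤ a} × ℤ => (z.1, z.2 - n)) fun z w h => by
          obtain ⟨h1, h2⟩ := Prod.mk.inj h
          exact Prod.ext h1 (sub_left_injective h2)
      refine h.congr fun z => ?_
      simp only [Function.comp, hpow]
      ring)
    (fun x => by
      have h := ((summable_pow_natAbs hq0.le hq1).mul_left (M ^ 2)).comp_injective
        (i := fun a : {a : ℤ // n ≤ a} => (a : ℤ) + (x - n) + 1) fun a b h =>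
          Subtype.ext (by simp only at h; omega)
      exact h.congr fun a => (hpow _).symm)
  have hK := fun a b : {a : ℤ // n ≤ a} => (Kker_eq_tsum_shift t t' σ n a b).symm
  have hL : ∀ x y : ℤ, ∑' a : {a : ℤ // n ≤ a},
      (σ (x - n) : ℂ) * Jcoef (-t) (-t') (-(a + (x - n) + 1)) * Jcoef t t' (a + (y - n) + 1)
        = (σ (x - n) : ℂ) * Kker t t' posInd y x := fun x y => by
    rw [Kker_posInd_eq_tsum t t' n, ← tsum_mul_left]
    exact tsum_congr fun a => by ring
  simp only [hK, hL] at hleft hright heq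
  refine ⟨hleft, hright.1, hright.2, ?_⟩
  rw [fredholmSeries]
  exact tsum_congr fun m => by rw [heq m]

end
end
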